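/- Let φ be a C^∞ function on a neighborhood of the origin in ℝ² that has a singularity of type E₆ at the origin. Then there exist an invertible linear map T : ℝ² → ℝ², an integer m ≥ 2, C^∞ functions b₃ of two variables and b₁, b₀, ω of one variable, all defined near the origin, with b₃(0,0) ≠ 0 and b₀(0) ≠ 0, such that for all (x₁,x₂) in a neighborhood of the origin: φ(T(x₁,x₂)) = b₃(x₁,x₂)·(x₂ − x₁^m·ω(x₁))³ + x₂·x₁⁴·b₁(x₁) + x₁⁴·b₀(x₁). -/

import Mathlib

open Set

/-- `φ` (with domain `U`, a neighborhood of the origin) has a singularity of type `E₆`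
at the origin. -/
def HasE6 (φ : ℝ × ℝ → ℝ) (U : Set (ℝ × ℝ)) : Prop :=
  ∃ V ∈ nhds (0 : ℝ × ℝ), ∃ ϕ : ℝ × ℝ → ℝ × ℝ, ∃ ε : ℝ,
    (ε = 1 ∨ ε = -1) ∧ ContDiffOn ℝ 1 ϕ V ∧ ϕ 0 = 0 ∧ ϕ '' V ⊆ U ∧
    LinearMap.det ((fderiv ℝ ϕ 0) : (ℝ × ℝ) →ₗ[ℝ] ℝ × ℝ) ≠ 0 ∧
    ∀ y ∈ V, φ (ϕ y) = ε * y.1 ^ 4 + y.2 ^ 3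

section

open Filter Topology ContDiff

theorem hasFDerivAt_intervalIntegral_of_contDiff {X F : Type} [NormedAddCommGroup X]
    [NormedSpace ℝ X] [FiniteDimensional ℝ X] [NormedAddCommGroup F] [NormedSpace ℝ F]
    {f : X × ℝ → F} (hf : ContDiff ℝ ∞ f) (a b : ℝ) (x : X) :
    HasFDerivAt (fun x => ∫ s in a..b, f (x, s))
      (∫ s in a..b, (fderiv ℝ f (x, s)).comp (ContinuousLinearMap.inl ℝ X ℝ)) x := by
  have : ProperSpace X := FiniteDimensional.proper_real X
  have hc : Continuous fun p : X × ℝ =>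
      (fderiv ℝ f p).comp (ContinuousLinearMap.inl ℝ X ℝ) :=
    (hf.continuous_fderiv (by simp)).clm_comp continuous_const
  obtain ⟨C, hC⟩ := ((isCompact_closedBall x 1).prod (isCompact_uIcc (a := a) (b := b))
    ).exists_bound_of_continuousOn hc.continuousOn
  refine intervalIntegral.hasFDerivAt_integral_of_dominated_of_fderiv_le
    (F' := fun x s => (fderiv ℝ f (x, s)).comp (ContinuousLinearMap.inl ℝ X ℝ))
    (bound := fun _ => C) (Metric.closedBall_mem_nhds x one_pos) ?_ ?_ ?_ ?_ ?_ ?_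
  · exact .of_forall fun y => (hf.continuous.comp (by fun_prop)).aestronglyMeasurable
  · exact (hf.continuous.comp (by fun_prop)).intervalIntegrable _ _
  · exact (hc.comp (by fun_prop : Continuous fun s : ℝ => (x, s))).aestronglyMeasurable
  · exact .of_forall fun s hs y hy => hC (y, s) ⟨hy, uIoc_subset_uIcc hs⟩
  · exact intervalIntegrable_const
  · refine .of_forall fun s _ y _ => ?_
    exact ((hf.differentiable (by simp)) (y, s)).hasFDerivAt.comp y
      (hasFDerivAt_prodMk_left y s)

theorem contDiff_intervalIntegral {X F : Type} [NormedAddCommGroup X]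
    [NormedSpace ℝ X] [FiniteDimensional ℝ X] [NormedAddCommGroup F] [NormedSpace ℝ F]
    {f : X × ℝ → F} (hf : ContDiff ℝ ∞ f) (a b : ℝ) :
    ContDiff ℝ ∞ fun x => ∫ s in a..b, f (x, s) := by
  refine contDiff_infty.2 fun n => ?_
  induction n generalizing F with
  | zero =>
    refine contDiff_zero.2 (continuous_iff_continuousAt.2 fun x => ?_)
    exact (hasFDerivAt_intervalIntegral_of_contDiff hf a b x).continuousAt
  | succ n ih =>
    refine contDiff_succ_iff_hasFDerivAt.2
      ⟨_, ih (f := fun p => (fderiv ℝ f p).comp (ContinuousLinearMap.inl ℝ X ℝ)) ?_,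
        hasFDerivAt_intervalIntegral_of_contDiff hf a b⟩
    exact (hf.fderiv_right (by simp)).clm_comp contDiff_const

/-- Hadamard's lemma with parameters. -/
theorem exists_contDiff_eq_add_mul {X : Type} [NormedAddCommGroup X] [NormedSpace ℝ X]
    [FiniteDimensional ℝ X] {f : X × ℝ → ℝ} (hf : ContDiff ℝ ∞ f) :
    ∃ g : X × ℝ → ℝ, ContDiff ℝ ∞ g ∧ ∀ x z, f (x, z) = f (x, 0) + z * g (x, z) := by
  have hd : ContDiff ℝ ∞ fun p : X × ℝ => fderiv ℝ f p (0, 1) :=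
    (hf.fderiv_right (by simp)).clm_apply contDiff_const
  refine ⟨fun p => ∫ s in (0 : ℝ)..1, fderiv ℝ f (p.1, s * p.2) (0, 1),
    contDiff_intervalIntegral (f := fun q : (X × ℝ) × ℝ => fderiv ℝ f (q.1.1, q.2 * q.1.2) (0, 1))
      (hd.comp (by fun_prop)) 0 1, fun x z => ?_⟩
  have h : ∀ s : ℝ, HasDerivAt (fun s => f (x, s * z)) (z * fderiv ℝ f (x, s * z) (0, 1)) s := by
    intro s
    have h1 : HasDerivAt (fun s : ℝ => (x, s * z)) ((0 : X), z) s :=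
      (hasDerivAt_const s x).prodMk (hasDerivAt_mul_const z)
    have h2 := ((hf.differentiable (by simp)) (x, s * z)).hasFDerivAt.comp_hasDerivAt s h1
    have h3 : ((0 : X), z) = z • ((0 : X), (1 : ℝ)) := by simp
    rw [h3, map_smul, smul_eq_mul] at h2
    exact h2
  have h4 := intervalIntegral.integral_eq_sub_of_hasDerivAt (a := 0) (b := 1) (fun s _ => h s)
    ((continuous_const.mul (hd.continuous.comp
      (by fun_prop : Continuous fun s : ℝ => (x, s * z)))).intervalIntegrable _ _)
  rw [intervalIntegral.integral_const_mul] at h4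
  simp only [one_mul, zero_mul] at h4
  linarith

theorem exists_contDiff_eventuallyEq {X : Type} [NormedAddCommGroup X] [NormedSpace ℝ X]
    [FiniteDimensional ℝ X] {f : X → ℝ} {U : Set X} {a : X} (hU : U ∈ 𝓝 a)
    (hf : ContDiffOn ℝ ∞ f U) : ∃ g : X → ℝ, ContDiff ℝ ∞ g ∧ g =ᶠ[𝓝 a] f := by
  obtain ⟨r, hr, hrU⟩ := Metric.nhds_basis_closedBall.mem_iff.1 (interior_mem_nhds.2 hU)
  let β : ContDiffBump a := ⟨r / 2, r, by positivity, by linarith⟩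
  refine ⟨fun x => β x * f x, contDiff_iff_contDiffAt.2 fun x => ?_, ?_⟩
  · by_cases hx : x ∈ interior U
    · exact β.contDiff.contDiffAt.mul (hf.contDiffAt (mem_interior_iff_mem_nhds.1 hx))
    · have hx' : x ∉ tsupport β := fun h => hx (hrU (by rwa [β.tsupport_eq] at h))
      refine contDiffAt_const (c := (0 : ℝ)) |>.congr_of_eventuallyEq ?_
      filter_upwards [notMem_tsupport_iff_eventuallyEq.1 hx'] with y hy
      simp [hy]
  · filter_upwards [β.eventuallyEq_one] with x hx
    simp [hx]

theorem exists_contDiff_implicit {f : ℝ × ℝ → ℝ} (hf : ContDiff ℝ ∞ f) {u : ℝ × ℝ}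
    (hu : f u = 0) (hd : fderiv ℝ f u (0, 1) ≠ 0) :
    ∃ g : ℝ → ℝ, ContDiff ℝ ∞ g ∧ g u.1 = u.2 ∧ ∀ᶠ x in 𝓝 u.1, f (x, g x) = 0 := by
  have hinv : ∀ v, fderiv ℝ f v (0, 1) ≠ 0 →
      (fderiv ℝ f v ∘L .inr ℝ ℝ ℝ).IsInvertible := fun v hv =>
    ⟨ContinuousLinearEquiv.unitsEquivAut ℝ (Units.mk0 _ hv), by ext; simp⟩
  have hcd : Continuous fun v => fderiv ℝ f v (0, 1) :=
    (hf.continuous_fderiv (by simp)).clm_apply continuous_const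
  have hn : (∞ : WithTop ℕ∞) ≠ 0 := by simp
  set ψ := hf.contDiffAt.implicitFunction hn (hinv u hd) with hψ
  have hψu : ψ u.1 = u.2 := hf.contDiffAt.implicitFunction_apply_self hn (hinv u hd)
  have hψz : ∀ᶠ x in 𝓝 u.1, f (x, ψ x) = 0 := by
    simpa [hu] using hf.contDiffAt.eventually_apply_implicitFunction hn (hinv u hd)
  have hψs : ContDiffAt ℝ ∞ ψ u.1 := hf.contDiffAt.contDiffAt_implicitFunction hn (hinv u hd)
  have hψc : ∀ᶠ x in 𝓝 u.1, ContinuousAt ψ x := by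
    filter_upwards [(hψs.of_le (m := 1) (by simp)).eventually (by simp)] with x hx
    exact hx.continuousAt
  have hψd : ∀ᶠ x in 𝓝 u.1, fderiv ℝ f (x, ψ x) (0, 1) ≠ 0 := by
    have : ContinuousAt (fun x => fderiv ℝ f (x, ψ x) (0, 1)) u.1 :=
      hcd.continuousAt.comp (continuousAt_id.prodMk hψs.continuousAt)
    exact this.eventually_ne (by simpa [hψu] using hd)
  have hsm : ∀ᶠ x in 𝓝 u.1, ContDiffAt ℝ ∞ ψ x := by
    filter_upwards [hψz.eventually_nhds, hψc, hψd] with x hx hxc hxd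
    refine (hf.contDiffAt.contDiffAt_implicitFunction (u := (x, ψ x)) hn
      (hinv _ hxd)).congr_of_eventuallyEq ?_
    have h1 := hf.contDiffAt.eventually_apply_eq_iff_implicitFunction (u := (x, ψ x)) hn
      (hinv _ hxd)
    have h2 : Tendsto (fun y => (y, ψ y)) (𝓝 x) (𝓝 (x, ψ x)) :=
      continuousAt_id.prodMk hxc
    filter_upwards [h2.eventually h1, hx] with y hy hy'
    exact ((hy.1 (by rw [hy', hx.self_of_nhds])).symm)
  obtain ⟨g, hg, hgψ⟩ := exists_contDiff_eventuallyEq (f := ψ) hsm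
    (fun x hx => ContDiffAt.contDiffWithinAt hx)
  refine ⟨g, hg, by rw [hgψ.self_of_nhds, hψu], ?_⟩
  filter_upwards [hgψ, hψz] with x h1 h2
  rw [h1, h2]

/-- Third order Taylor expansion in the last variable, with parameters. -/
theorem exists_contDiff_taylor_three {X : Type} [NormedAddCommGroup X] [NormedSpace ℝ X]
    [FiniteDimensional ℝ X] {f : X × ℝ → ℝ} (hf : ContDiff ℝ ∞ f) :
    ∃ (f₀ f₁ f₂ : X → ℝ) (f₃ : X × ℝ → ℝ), ContDiff ℝ ∞ f₀ ∧ ContDiff ℝ ∞ f₁ ∧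
      ContDiff ℝ ∞ f₂ ∧ ContDiff ℝ ∞ f₃ ∧
      ∀ x z, f (x, z) = f₀ x + z * f₁ x + z ^ 2 * f₂ x + z ^ 3 * f₃ (x, z) := by
  obtain ⟨g, hg, hfg⟩ := exists_contDiff_eq_add_mul hf
  obtain ⟨k, hk, hgk⟩ := exists_contDiff_eq_add_mul hg
  obtain ⟨l, hl, hkl⟩ := exists_contDiff_eq_add_mul hk
  refine ⟨fun x => f (x, 0), fun x => g (x, 0), fun x => k (x, 0), l, hf.comp (by fun_prop),
    hg.comp (by fun_prop), hk.comp (by fun_prop), hl, fun x z => ?_⟩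
  rw [hfg, hgk, hkl]
  ring

theorem exists_contDiff_cubic_add_affine {H K R : ℝ × ℝ → ℝ} (hH : ContDiff ℝ ∞ H)
    (hK : ContDiff ℝ ∞ K) (hR : ContDiff ℝ ∞ R) (hH0 : H (0, 0) ≠ 0) :
    ∃ (b₃ : ℝ × ℝ → ℝ) (b₁ b₀ w : ℝ → ℝ), ContDiff ℝ ∞ b₃ ∧ ContDiff ℝ ∞ b₁ ∧
      ContDiff ℝ ∞ b₀ ∧ ContDiff ℝ ∞ w ∧ b₃ (0, 0) = H (0, 0) ∧ b₀ 0 = R (0, 0) ∧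
      ∀ᶠ x₁ in 𝓝 (0 : ℝ), ∀ x₂, x₂ ^ 3 * H (x₁, x₂) + x₁ ^ 2 * x₂ ^ 2 * K (x₁, x₂) +
          x₁ ^ 4 * R (x₁, x₂) =
        b₃ (x₁, x₂) * (x₂ - x₁ ^ 2 * w x₁) ^ 3 + x₂ * x₁ ^ 4 * b₁ x₁ + x₁ ^ 4 * b₀ x₁ := by
  have expand : ∀ f : ℝ × ℝ → ℝ, ContDiff ℝ ∞ f →
      ∃ (f₀ f₁ f₂ : ℝ × ℝ → ℝ) (f₃ : (ℝ × ℝ) × ℝ → ℝ), ContDiff ℝ ∞ f₀ ∧ ContDiff ℝ ∞ f₁ ∧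
        ContDiff ℝ ∞ f₂ ∧ ContDiff ℝ ∞ f₃ ∧ f₀ = f ∧ ∀ x s y, f (x, y) =
          f₀ (x, s) + (y - s) * f₁ (x, s) + (y - s) ^ 2 * f₂ (x, s) +
            (y - s) ^ 3 * f₃ ((x, s), y - s) := by
    intro f hf
    obtain ⟨f₀, f₁, f₂, f₃, h₀, h₁, h₂, h₃, h⟩ := exists_contDiff_taylor_three
      (f := fun p : (ℝ × ℝ) × ℝ => f (p.1.1, p.1.2 + p.2)) (hf.comp (by fun_prop))
    refine ⟨f₀, f₁, f₂, f₃, h₀, h₁, h₂, h₃, funext fun p => ?_, fun x s y => ?_⟩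
    · simpa using (h p 0).symm
    · simpa using h (x, s) (y - s)
  obtain ⟨H₀, H₁, H₂, H₃, cH₀, cH₁, cH₂, cH₃, eH, hH'⟩ := expand H hH
  obtain ⟨K₀, K₁, K₂, K₃, cK₀, cK₁, cK₂, cK₃, eK, hK'⟩ := expand K hK
  obtain ⟨R₀, R₁, R₂, R₃, cR₀, cR₁, cR₂, cR₃, eR, hR'⟩ := expand R hR
  set E : ℝ × ℝ → ℝ := fun p =>
    3 * p.2 * H₀ (p.1, p.1 ^ 2 * p.2) + 3 * p.1 ^ 2 * p.2 ^ 2 * H₁ (p.1, p.1 ^ 2 * p.2) +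
      p.1 ^ 4 * p.2 ^ 3 * H₂ (p.1, p.1 ^ 2 * p.2) + K₀ (p.1, p.1 ^ 2 * p.2) +
      2 * p.1 ^ 2 * p.2 * K₁ (p.1, p.1 ^ 2 * p.2) +
      p.1 ^ 4 * p.2 ^ 2 * K₂ (p.1, p.1 ^ 2 * p.2) + p.1 ^ 2 * R₂ (p.1, p.1 ^ 2 * p.2) with hE
  have cE : ContDiff ℝ ∞ E := by fun_prop
  have hE0 : ∀ v, E (0, v) = 3 * v * H (0, 0) + K (0, 0) := fun v => by simp [hE, eH, eK]
  set v₀ := -K (0, 0) / (3 * H (0, 0)) with hv₀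
  have hEd : fderiv ℝ E (0, v₀) (0, 1) = 3 * H (0, 0) := by
    have h1 := ((cE.differentiable (by simp)) (0, v₀)).hasFDerivAt.comp_hasDerivAt v₀
      ((hasDerivAt_const v₀ (0 : ℝ)).prodMk (hasDerivAt_id v₀))
    have h2 : HasDerivAt (fun v => E (0, v)) (3 * H (0, 0)) v₀ := by
      simp only [hE0]
      simpa using (((hasDerivAt_id v₀).const_mul 3).mul_const (H (0, 0))).add_const (K (0, 0))
    exact h1.unique h2
  obtain ⟨w, cw, -, hw⟩ := exists_contDiff_implicit cE (u := (0, v₀))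
    (by rw [hE0, hv₀]; field_simp; ring) (by rw [hEd]; simpa using hH0)
  refine ⟨fun p =>
      (fun s z => H₀ (p.1, s) + z * H₁ (p.1, s) + z ^ 2 * H₂ (p.1, s) + z ^ 3 * H₃ ((p.1, s), z) +
        3 * s * (H₁ (p.1, s) + z * H₂ (p.1, s) + z ^ 2 * H₃ ((p.1, s), z)) +
        3 * s ^ 2 * (H₂ (p.1, s) + z * H₃ ((p.1, s), z)) + s ^ 3 * H₃ ((p.1, s), z) +
        p.1 ^ 2 * (K₁ (p.1, s) + z * K₂ (p.1, s) + z ^ 2 * K₃ ((p.1, s), z) +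
          2 * s * (K₂ (p.1, s) + z * K₃ ((p.1, s), z)) + s ^ 2 * K₃ ((p.1, s), z)) +
        p.1 ^ 4 * R₃ ((p.1, s), z)) (p.1 ^ 2 * w p.1) (p.2 - p.1 ^ 2 * w p.1),
    fun x => 3 * w x ^ 2 * H₀ (x, x ^ 2 * w x) + x ^ 2 * w x ^ 3 * H₁ (x, x ^ 2 * w x) +
      2 * w x * K₀ (x, x ^ 2 * w x) + x ^ 2 * w x ^ 2 * K₁ (x, x ^ 2 * w x) +
      R₁ (x, x ^ 2 * w x),
    fun x => x ^ 2 * w x ^ 3 * H₀ (x, x ^ 2 * w x) + x ^ 2 * w x ^ 2 * K₀ (x, x ^ 2 * w x) +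
      R₀ (x, x ^ 2 * w x) - x ^ 2 * w x *
      (3 * w x ^ 2 * H₀ (x, x ^ 2 * w x) + x ^ 2 * w x ^ 3 * H₁ (x, x ^ 2 * w x) +
      2 * w x * K₀ (x, x ^ 2 * w x) + x ^ 2 * w x ^ 2 * K₁ (x, x ^ 2 * w x) +
      R₁ (x, x ^ 2 * w x)), w, by fun_prop, by fun_prop, by fun_prop, cw, by simp [eH],
      by simp [eR], ?_⟩
  filter_upwards [hw] with x hx y
  rw [hH' x (x ^ 2 * w x) y, hK' x (x ^ 2 * w x) y, hR' x (x ^ 2 * w x) y]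
  simp only [hE] at hx
  linear_combination x ^ 2 * (y - x ^ 2 * w x) ^ 2 * hx

/-- A shear removes the monomial `x₁ ^ 3 * x₂`. -/
theorem exists_contDiff_shear {H K R : ℝ × ℝ → ℝ} (hH : ContDiff ℝ ∞ H)
    (hK : ContDiff ℝ ∞ K) (hR : ContDiff ℝ ∞ R) (hR0 : R (0, 0) ≠ 0) (c : ℝ) :
    ∃ (a : ℝ) (H' K' R' : ℝ × ℝ → ℝ), ContDiff ℝ ∞ H' ∧ ContDiff ℝ ∞ K' ∧ ContDiff ℝ ∞ R' ∧
      H' (0, 0) = H (0, 0) ∧ R' (0, 0) = R (0, 0) ∧ ∀ x y : ℝ,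
        y ^ 3 * H (x - a * y, y) + (x - a * y) ^ 2 * y ^ 2 * K (x - a * y, y) +
          c * (x - a * y) ^ 3 * y + (x - a * y) ^ 4 * R (x - a * y, y) =
        y ^ 3 * H' (x, y) + x ^ 2 * y ^ 2 * K' (x, y) + x ^ 4 * R' (x, y) := by
  set a := c / (4 * R (0, 0)) with ha
  have hc : c = 4 * a * R (0, 0) := by rw [ha]; field_simp
  obtain ⟨R₂, cR₂, hR₂⟩ := exists_contDiff_eq_add_mul
    (f := fun p : ℝ × ℝ => R (p.1 - a * p.2, p.2)) (hR.comp (by fun_prop))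
  obtain ⟨R₁, cR₁, hR₁⟩ := exists_contDiff_eq_add_mul
    (f := fun p : ℝ × ℝ => R (p.2, 0)) (hR.comp (by fun_prop))
  refine ⟨a,
    fun p => H (p.1 - a * p.2, p.2) + (-2 * a * p.1 + a ^ 2 * p.2) * K (p.1 - a * p.2, p.2) +
      3 * a ^ 2 * c * p.1 - a ^ 3 * c * p.2 +
      (-4 * a ^ 3 * p.1 + a ^ 4 * p.2) * R (p.1 - a * p.2, p.2),
    fun p => K (p.1 - a * p.2, p.2) - 3 * a * c - 4 * a * p.1 * R₂ p +
      6 * a ^ 2 * R (p.1 - a * p.2, p.2),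
    fun p => R (p.1 - a * p.2, p.2) - 4 * a * p.2 * R₁ (0, p.1),
    by fun_prop, by fun_prop, by fun_prop, by simp, by simp, fun x y => ?_⟩
  have h2 := hR₂ x y
  have h1 := hR₁ 0 x
  simp only [mul_zero, sub_zero] at h1 h2 ⊢
  rw [h1] at h2
  linear_combination (-4 * a * x ^ 3 * y) * h2 + x ^ 3 * y * hc

theorem exists_contDiff_expansion {F : ℝ × ℝ → ℝ} (hF : ContDiff ℝ ∞ F) :
    ∃ (c₀₀ c₁₀ c₀₁ c₂₀ c₁₁ c₀₂ c₃₀ c₂₁ c₁₂ c₃₁ : ℝ) (H K R : ℝ × ℝ → ℝ),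
      ContDiff ℝ ∞ H ∧ ContDiff ℝ ∞ K ∧ ContDiff ℝ ∞ R ∧ ∀ x y, F (x, y) =
        c₀₀ + (c₁₀ * x + c₀₁ * y) + (c₂₀ * x ^ 2 + c₁₁ * x * y + c₀₂ * y ^ 2) +
          (c₃₀ * x ^ 3 + c₂₁ * x ^ 2 * y + c₁₂ * x * y ^ 2) +
          (y ^ 3 * H (x, y) + x ^ 2 * y ^ 2 * K (x, y) + c₃₁ * x ^ 3 * y + x ^ 4 * R (x, y)) := by
  obtain ⟨f₀, f₁, f₂, f₃, h₀, h₁, h₂, h₃, h⟩ := exists_contDiff_taylor_three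
    (f := fun p : ℝ × ℝ => F (p.2, p.1)) (hF.comp (by fun_prop))
  obtain ⟨R, hR, hfR⟩ := exists_contDiff_eq_add_mul h₃
  have expand : ∀ f : ℝ → ℝ, ContDiff ℝ ∞ f → ∃ (c₀ c₁ c₂ : ℝ) (g : ℝ → ℝ), ContDiff ℝ ∞ g ∧
      ∀ y, f y = c₀ + y * c₁ + y ^ 2 * c₂ + y ^ 3 * g y := by
    intro f hf
    obtain ⟨g₀, g₁, g₂, g₃, -, -, -, cg, hg⟩ := exists_contDiff_taylor_three
      (f := fun p : ℝ × ℝ => f p.2) (hf.comp (by fun_prop))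
    exact ⟨g₀ 0, g₁ 0, g₂ 0, fun y => g₃ (0, y), cg.comp (by fun_prop), hg 0⟩
  obtain ⟨a₀, a₁, a₂, g₀, cg₀, hg₀⟩ := expand f₀ h₀
  obtain ⟨b₀, b₁, b₂, g₁, cg₁, hg₁⟩ := expand f₁ h₁
  obtain ⟨d₀, d₁, d₂, g₂, cg₂, hg₂⟩ := expand f₂ h₂
  obtain ⟨e₀, e₁, e₂, g₃, cg₃, hg₃⟩ := expand (fun y => f₃ (y, 0)) (h₃.comp (by fun_prop))
  refine ⟨a₀, b₀, a₁, d₀, b₁, a₂, e₀, d₁, b₂, e₁, fun p => g₀ p.2 + p.1 * g₁ p.2,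
    fun p => d₂ + p.2 * g₂ p.2 + p.1 * (e₂ + p.2 * g₃ p.2), fun p => R (p.2, p.1),
    by fun_prop, by fun_prop, hR.comp (by fun_prop), fun x y => ?_⟩
  have := h y x
  rw [hfR, hg₀, hg₁, hg₂, hg₃] at this
  linear_combination this

theorem eq_zero_of_eventually_pow_mul_eq_zero {Y : Type} [TopologicalSpace Y] {Γ : Y → ℝ}
    (hΓ : Continuous Γ) {w : ℝ → Y} {y : Y} (hw : Tendsto w (𝓝[≠] 0) (𝓝 y)) (k : ℕ)
    (h : ∀ᶠ t in 𝓝[≠] (0 : ℝ), t ^ k * Γ (w t) = 0) : Γ y = 0 := by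
  refine tendsto_nhds_unique ((hΓ.tendsto y).comp hw) (tendsto_const_nhds.congr' ?_)
  filter_upwards [h, self_mem_nhdsWithin] with t ht ht0
  exact ((mul_eq_zero.1 ht).resolve_left (pow_ne_zero k ht0)).symm

theorem exists_tendsto_of_hasFDerivAt_id {ψ : ℝ × ℝ → ℝ × ℝ} (h0 : ψ 0 = 0)
    (hψ : HasFDerivAt ψ (ContinuousLinearMap.id ℝ (ℝ × ℝ)) 0) (a b : ℝ) :
    ∃ p q : ℝ → ℝ, Tendsto p (𝓝[≠] 0) (𝓝 a) ∧ Tendsto q (𝓝[≠] 0) (𝓝 b) ∧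
      ∀ᶠ t in 𝓝[≠] (0 : ℝ), ψ (t * a, t * b) = (t * p t, t * q t) := by
  have h1 : HasDerivAt (fun t : ℝ => ψ (t * a, t * b)) (a, b) 0 := by
    have h2 : HasDerivAt (fun t : ℝ => (t * a, t * b)) (a, b) 0 :=
      (hasDerivAt_mul_const a).prodMk (hasDerivAt_mul_const b)
    have hψ' : HasFDerivAt ψ (ContinuousLinearMap.id ℝ (ℝ × ℝ)) ((0 : ℝ) * a, (0 : ℝ) * b) := by
      rw [zero_mul, zero_mul]
      exact hψ
    exact hψ'.comp_hasDerivAt (0 : ℝ) h2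
  have h3 := hasDerivAt_iff_tendsto_slope_zero.1 h1
  refine ⟨_, _, (continuous_fst.tendsto _).comp h3, (continuous_snd.tendsto _).comp h3, ?_⟩
  filter_upwards [self_mem_nhdsWithin] with t ht
  have ht : t ≠ 0 := ht
  have h0' : ψ (0, 0) = 0 := h0
  ext <;> simp [h0', ht]

theorem three_jet_of_comp_eq {F : ℝ × ℝ → ℝ} {ψ : ℝ × ℝ → ℝ × ℝ} {ε : ℝ} (h0 : ψ 0 = 0)
    (hψ : HasFDerivAt ψ (ContinuousLinearMap.id ℝ (ℝ × ℝ)) 0)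
    (hFψ : ∀ᶠ y in 𝓝 (0 : ℝ × ℝ), F (ψ y) = ε * y.1 ^ 4 + y.2 ^ 3)
    {c₀₀ c₁₀ c₀₁ c₂₀ c₁₁ c₀₂ c₃₀ c₂₁ c₁₂ c₃₁ : ℝ} {H K R : ℝ × ℝ → ℝ}
    (hH : Continuous H) (hK : Continuous K) (hR : Continuous R)
    (hF : ∀ x y, F (x, y) =
      c₀₀ + (c₁₀ * x + c₀₁ * y) + (c₂₀ * x ^ 2 + c₁₁ * x * y + c₀₂ * y ^ 2) +
        (c₃₀ * x ^ 3 + c₂₁ * x ^ 2 * y + c₁₂ * x * y ^ 2) +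
        (y ^ 3 * H (x, y) + x ^ 2 * y ^ 2 * K (x, y) + c₃₁ * x ^ 3 * y + x ^ 4 * R (x, y))) :
    (∀ x y, F (x, y) =
      y ^ 3 * H (x, y) + x ^ 2 * y ^ 2 * K (x, y) + c₃₁ * x ^ 3 * y + x ^ 4 * R (x, y)) ∧
    H (0, 0) = 1 := by
  have e0 : c₀₀ = 0 := by
    have h1 := hFψ.self_of_nhds
    have h2 := hF 0 0
    rw [h0] at h1
    simp at h1 h2
    rw [← h2]; exact h1
  have hlim : ∀ a b : ℝ, ∃ p q : ℝ → ℝ,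
      Tendsto (fun t => (t, p t, q t)) (𝓝[≠] 0) (𝓝 (0, a, b)) ∧
      ∀ᶠ t in 𝓝[≠] (0 : ℝ), F (t * p t, t * q t) = ε * (t * a) ^ 4 + (t * b) ^ 3 := by
    intro a b
    obtain ⟨p, q, hp, hq, hpq⟩ := exists_tendsto_of_hasFDerivAt_id h0 hψ a b
    have ht : Tendsto (fun t : ℝ => t) (𝓝[≠] 0) (𝓝 0) := nhdsWithin_le_nhds
    refine ⟨p, q, ht.prodMk_nhds (hp.prodMk_nhds hq), ?_⟩
    have hl : Tendsto (fun t : ℝ => (t * a, t * b)) (𝓝[≠] 0) (𝓝 (0, 0)) := by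
      have := (ht.mul_const a).prodMk_nhds (ht.mul_const b)
      simpa using this
    filter_upwards [hpq, hl.eventually hFψ] with t h1 h2
    rw [← h1, h2]
  let S : ℝ × ℝ × ℝ → ℝ := fun w => w.2.2 ^ 3 * H (w.1 * w.2.1, w.1 * w.2.2) +
    w.1 * (w.2.1 ^ 2 * w.2.2 ^ 2 * K (w.1 * w.2.1, w.1 * w.2.2) + c₃₁ * w.2.1 ^ 3 * w.2.2 +
      w.2.1 ^ 4 * R (w.1 * w.2.1, w.1 * w.2.2))
  have hS : Continuous S := by fun_prop
  have e1 : ∀ a b, c₁₀ * a + c₀₁ * b = 0 := by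
    intro a b
    obtain ⟨p, q, hw, hpq⟩ := hlim a b
    have := eq_zero_of_eventually_pow_mul_eq_zero (Γ := fun w : ℝ × ℝ × ℝ =>
      c₁₀ * w.2.1 + c₀₁ * w.2.2 + w.1 * (c₂₀ * w.2.1 ^ 2 + c₁₁ * w.2.1 * w.2.2 + c₀₂ * w.2.2 ^ 2)
      + w.1 ^ 2 * (c₃₀ * w.2.1 ^ 3 + c₂₁ * w.2.1 ^ 2 * w.2.2 + c₁₂ * w.2.1 * w.2.2 ^ 2 + S w
        - b ^ 3 - w.1 * ε * a ^ 4)) (by fun_prop) hw 1 (by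
        filter_upwards [hpq] with t ht
        rw [hF, e0] at ht
        linear_combination ht)
    simpa using this
  obtain rfl : c₁₀ = 0 := by simpa using e1 1 0
  obtain rfl : c₀₁ = 0 := by simpa using e1 0 1
  have e2 : ∀ a b, c₂₀ * a ^ 2 + c₁₁ * a * b + c₀₂ * b ^ 2 = 0 := by
    intro a b
    obtain ⟨p, q, hw, hpq⟩ := hlim a b
    have := eq_zero_of_eventually_pow_mul_eq_zero (Γ := fun w : ℝ × ℝ × ℝ =>
      (c₂₀ * w.2.1 ^ 2 + c₁₁ * w.2.1 * w.2.2 + c₀₂ * w.2.2 ^ 2)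
      + w.1 * (c₃₀ * w.2.1 ^ 3 + c₂₁ * w.2.1 ^ 2 * w.2.2 + c₁₂ * w.2.1 * w.2.2 ^ 2 + S w
        - b ^ 3 - w.1 * ε * a ^ 4)) (by fun_prop) hw 2 (by
        filter_upwards [hpq] with t ht
        rw [hF, e0] at ht
        linear_combination ht)
    simpa using this
  obtain rfl : c₂₀ = 0 := by simpa using e2 1 0
  obtain rfl : c₀₂ = 0 := by simpa using e2 0 1
  obtain rfl : c₁₁ = 0 := by simpa using e2 1 1
  have e3 : ∀ a b, c₃₀ * a ^ 3 + c₂₁ * a ^ 2 * b + c₁₂ * a * b ^ 2 + b ^ 3 * H (0, 0) - b ^ 3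
      = 0 := by
    intro a b
    obtain ⟨p, q, hw, hpq⟩ := hlim a b
    have := eq_zero_of_eventually_pow_mul_eq_zero (Γ := fun w : ℝ × ℝ × ℝ =>
      c₃₀ * w.2.1 ^ 3 + c₂₁ * w.2.1 ^ 2 * w.2.2 + c₁₂ * w.2.1 * w.2.2 ^ 2 + S w
        - b ^ 3 - w.1 * ε * a ^ 4) (by fun_prop) hw 3 (by
        filter_upwards [hpq] with t ht
        rw [hF, e0] at ht
        linear_combination ht)
    simpa [S] using this
  obtain rfl : c₃₀ = 0 := by simpa using e3 1 0
  have hH0 : H (0, 0) = 1 := by have := e3 0 1; linarith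
  obtain rfl : c₂₁ = 0 := by linarith [e3 1 1, e3 1 (-1)]
  obtain rfl : c₁₂ = 0 := by linarith [e3 1 1]
  exact ⟨fun x y => by rw [hF, e0]; ring, hH0⟩

theorem four_jet_of_comp_eq {F : ℝ × ℝ → ℝ} {ψ : ℝ × ℝ → ℝ × ℝ} {ε : ℝ} (h0 : ψ 0 = 0)
    (hψ : ContDiffAt ℝ 1 ψ 0) (hψ' : fderiv ℝ ψ 0 = ContinuousLinearMap.id ℝ (ℝ × ℝ))
    (hFψ : ∀ᶠ y in 𝓝 (0 : ℝ × ℝ), F (ψ y) = ε * y.1 ^ 4 + y.2 ^ 3)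
    {c : ℝ} {H K R : ℝ × ℝ → ℝ}
    (hH : ContDiff ℝ ∞ H) (hK : ContDiff ℝ ∞ K) (hR : ContDiff ℝ ∞ R)
    (hF : ∀ x y, F (x, y) =
      y ^ 3 * H (x, y) + x ^ 2 * y ^ 2 * K (x, y) + c * x ^ 3 * y + x ^ 4 * R (x, y)) :
    R (0, 0) = ε := by
  have hFs : F = fun p => p.2 ^ 3 * H p + p.1 ^ 2 * p.2 ^ 2 * K p + c * p.1 ^ 3 * p.2 +
      p.1 ^ 4 * R p := funext fun p => hF p.1 p.2
  have hFd : Differentiable ℝ F := by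
    have : ContDiff ℝ ∞ F := by rw [hFs]; fun_prop
    exact this.differentiable (by simp)
  have hasDerivAt_fst : ∀ {f : ℝ × ℝ → ℝ}, Differentiable ℝ f → ∀ x y : ℝ,
      HasDerivAt (fun s => f (s, y)) (fderiv ℝ f (x, y) (1, 0)) x := fun hf x y =>
    (hf (x, y)).hasFDerivAt.comp_hasDerivAt x ((hasDerivAt_id x).prodMk (hasDerivAt_const x y))
  have continuous_fderiv_fst : ∀ {f : ℝ × ℝ → ℝ}, ContDiff ℝ ∞ f →
      Continuous fun p => fderiv ℝ f p (1, 0) := fun hf =>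
    (hf.continuous_fderiv (by simp)).clm_apply continuous_const
  have cH := continuous_fderiv_fst hH
  have cK := continuous_fderiv_fst hK
  have cR := continuous_fderiv_fst hR
  have hF₁ : ∀ x y, fderiv ℝ F (x, y) (1, 0) =
      y ^ 3 * fderiv ℝ H (x, y) (1, 0) + 2 * x * y ^ 2 * K (x, y) +
        x ^ 2 * y ^ 2 * fderiv ℝ K (x, y) (1, 0) + 3 * c * x ^ 2 * y + 4 * x ^ 3 * R (x, y) +
        x ^ 4 * fderiv ℝ R (x, y) (1, 0) := by
    intro x y
    refine (hasDerivAt_fst hFd x y).unique ?_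
    simp only [hF]
    have dH := hasDerivAt_fst (hH.differentiable (by simp)) x y
    have dK := hasDerivAt_fst (hK.differentiable (by simp)) x y
    have dR := hasDerivAt_fst (hR.differentiable (by simp)) x y
    have d2 : HasDerivAt (fun s : ℝ => s ^ 2) (2 * x) x := by simpa using hasDerivAt_pow 2 x
    have d3 : HasDerivAt (fun s : ℝ => s ^ 3) (3 * x ^ 2) x := by simpa using hasDerivAt_pow 3 x
    have d4 : HasDerivAt (fun s : ℝ => s ^ 4) (4 * x ^ 3) x := by simpa using hasDerivAt_pow 4 x
    convert! (((dH.const_mul (y ^ 3)).add ((d2.mul_const (y ^ 2)).mul dK)).add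
      ((d3.const_mul c).mul_const y)).add (d4.mul dR) using 1
    ring
  obtain ⟨p, q, hp, hq, hpq⟩ := exists_tendsto_of_hasFDerivAt_id h0
    (hψ' ▸ (hψ.differentiableAt one_ne_zero).hasFDerivAt) 1 0
  have ht : Tendsto (fun t : ℝ => t) (𝓝[≠] 0) (𝓝 0) := nhdsWithin_le_nhds
  have hl : Tendsto (fun t : ℝ => (t, (0 : ℝ))) (𝓝[≠] 0) (𝓝 0) := ht.prodMk_nhds tendsto_const_nhds
  have hD : Tendsto (fun t : ℝ => fderiv ℝ ψ (t, 0)) (𝓝[≠] 0)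
      (𝓝 (ContinuousLinearMap.id ℝ (ℝ × ℝ))) := by
    rw [← hψ']
    exact (hψ.continuousAt_fderiv one_ne_zero).tendsto.comp hl
  have key := eq_zero_of_eventually_pow_mul_eq_zero
    (Γ := fun w : ℝ × ℝ × ℝ × ((ℝ × ℝ) →L[ℝ] ℝ × ℝ) =>
      (w.2.2.1 ^ 3 * fderiv ℝ H (w.1 * w.2.1, w.1 * w.2.2.1) (1, 0) +
        2 * w.2.1 * w.2.2.1 ^ 2 * K (w.1 * w.2.1, w.1 * w.2.2.1) +
        w.1 * w.2.1 ^ 2 * w.2.2.1 ^ 2 * fderiv ℝ K (w.1 * w.2.1, w.1 * w.2.2.1) (1, 0) +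
        3 * c * w.2.1 ^ 2 * w.2.2.1 + 4 * w.2.1 ^ 3 * R (w.1 * w.2.1, w.1 * w.2.2.1) +
        w.1 * w.2.1 ^ 4 * fderiv ℝ R (w.1 * w.2.1, w.1 * w.2.2.1) (1, 0)) *
      ((w.2.2.2 (1, 0)).1 * (w.2.2.2 (0, 1)).2 - (w.2.2.2 (1, 0)).2 * (w.2.2.2 (0, 1)).1) -
      4 * ε * (w.2.2.2 (0, 1)).2)
    (by fun_prop) (ht.prodMk_nhds (hp.prodMk_nhds (hq.prodMk_nhds hD))) 3 (by
      have hdiff : ∀ᶠ y in 𝓝 (0 : ℝ × ℝ), DifferentiableAt ℝ ψ y := by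
        filter_upwards [hψ.eventually (by simp)] with y hy
        exact hy.differentiableAt one_ne_zero
      filter_upwards [hpq, hl.eventually hdiff, hl.eventually hFψ.eventually_nhds]
        with t h1 h2 h3
      simp only [mul_one, mul_zero] at h1
      have h4 : HasFDerivAt (fun y => F (ψ y)) ((fderiv ℝ F (ψ (t, 0))).comp (fderiv ℝ ψ (t, 0)))
          (t, 0) := (hFd _).hasFDerivAt.comp _ h2.hasFDerivAt
      have h5 := h4.congr_of_eventuallyEq (EventuallyEq.symm h3)
      have h6 := h5.comp_hasDerivAt t ((hasDerivAt_id t).prodMk (hasDerivAt_const t (0 : ℝ)))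
      have h7 := h5.comp_hasDerivAt (0 : ℝ)
        ((hasDerivAt_const (0 : ℝ) t).prodMk (hasDerivAt_id (0 : ℝ)))
      have h6' := h6.unique (f₁' := ε * (4 * t ^ 3)) (by
        simpa [Function.comp_def] using (hasDerivAt_pow 4 t).const_mul ε)
      have h7' := h7.unique (f₁' := 0) (by
        simpa [Function.comp_def] using ((hasDerivAt_pow 3 (0 : ℝ)).const_add (ε * t ^ 4)))
      have hlin : ∀ (L : (ℝ × ℝ) →L[ℝ] ℝ) (z : ℝ × ℝ), L z = z.1 * L (1, 0) + z.2 * L (0, 1) := by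
        intro L z
        rw [← smul_eq_mul, ← smul_eq_mul, ← map_smul, ← map_smul, ← map_add]
        congr 1
        ext <;> simp
      rw [h1, ContinuousLinearMap.comp_apply, hlin, hF₁] at h6' h7'
      linear_combination (fderiv ℝ ψ (t, 0) (0, 1)).2 * h6' - (fderiv ℝ ψ (t, 0) (1, 0)).2 * h7')
  simp at key
  linarith

/-- A `C¹` change of coordinates to the `E₆` normal form is tangent to the identity in suitable
linear coordinates. -/
theorem HasE6.exists_linear_normalization {φ : ℝ × ℝ → ℝ} {U : Set (ℝ × ℝ)} (h : HasE6 φ U) :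
    ∃ (A : (ℝ × ℝ) ≃L[ℝ] ℝ × ℝ) (ψ : ℝ × ℝ → ℝ × ℝ) (ε : ℝ), ε ≠ 0 ∧ ContDiffAt ℝ 1 ψ 0 ∧
      ψ 0 = 0 ∧ fderiv ℝ ψ 0 = ContinuousLinearMap.id ℝ (ℝ × ℝ) ∧
      ∀ᶠ y in 𝓝 (0 : ℝ × ℝ), φ (A (ψ y)) = ε * y.1 ^ 4 + y.2 ^ 3 := by
  obtain ⟨V, hV, ϕ, ε, hε, hϕ, hϕ0, -, hdet, hφϕ⟩ := h
  have hϕ1 : ContDiffAt ℝ 1 ϕ 0 := hϕ.contDiffAt hV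
  set A := (fderiv ℝ ϕ 0).toContinuousLinearEquivOfDetNeZero hdet with hA
  have hA' : (A : (ℝ × ℝ) →L[ℝ] ℝ × ℝ) = fderiv ℝ ϕ 0 := by ext <;> rfl
  refine ⟨A, fun y => A.symm (ϕ y), ε, by rcases hε with rfl | rfl <;> norm_num,
    A.symm.contDiff.contDiffAt.comp 0 hϕ1, by simp [hϕ0], ?_, ?_⟩
  · have h1 := A.symm.hasFDerivAt.comp (0 : ℝ × ℝ) (hϕ1.differentiableAt one_ne_zero).hasFDerivAt
    refine h1.fderiv.trans ?_
    rw [← hA']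
    exact A.coe_symm_comp_coe
  · filter_upwards [hV] with y hy
    simpa using hφϕ y hy

end

/-- a `C^∞` function with an `E₆` type singularity at the origin can be
written, after an invertible linear change of variables, as
`b₃(x)·(x₂ - x₁^m ω(x₁))³ + x₂ x₁⁴ b₁(x₁) + x₁⁴ b₀(x₁)` with `b₃(0,0) ≠ 0`, `b₀(0) ≠ 0`
and `m ≥ 2`, where `b₃, b₁, b₀, ω` are `C^∞` near the origin. -/
theorem stmt_3 (U : Set (ℝ × ℝ)) (hU : U ∈ nhds (0 : ℝ × ℝ))
    (φ : ℝ × ℝ → ℝ) (hφ : ContDiffOn ℝ (⊤ : ℕ∞) φ U) (h : HasE6 φ U) :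
    ∃ T : (ℝ × ℝ) →ₗ[ℝ] ℝ × ℝ, Function.Bijective T ∧
    ∃ m : ℕ, 2 ≤ m ∧
    ∃ (b₃ : ℝ × ℝ → ℝ) (b₁ b₀ ω : ℝ → ℝ) (δ : ℝ), 0 < δ ∧
      ContDiffOn ℝ (⊤ : ℕ∞) b₃ (Metric.ball (0 : ℝ × ℝ) δ) ∧
      ContDiffOn ℝ (⊤ : ℕ∞) b₁ (Ioo (-δ) δ) ∧
      ContDiffOn ℝ (⊤ : ℕ∞) b₀ (Ioo (-δ) δ) ∧
      ContDiffOn ℝ (⊤ : ℕ∞) ω (Ioo (-δ) δ) ∧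
      b₃ (0, 0) ≠ 0 ∧ b₀ 0 ≠ 0 ∧
      ∀ x ∈ Metric.ball (0 : ℝ × ℝ) δ,
        φ (T x) = b₃ x * (x.2 - x.1 ^ m * ω x.1) ^ 3 +
          x.2 * x.1 ^ 4 * b₁ x.1 + x.1 ^ 4 * b₀ x.1 := by
  obtain ⟨A, ψ, ε, hε, hψ, hψ0, hψ', hφψ⟩ := h.exists_linear_normalization
  obtain ⟨g, hg, hgφ⟩ := exists_contDiff_eventuallyEq hU hφ
  have hF : ContDiff ℝ (⊤ : ℕ∞) fun p => g (A p) := hg.comp A.contDiff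
  have hFψ : ∀ᶠ y in nhds (0 : ℝ × ℝ), g (A (ψ y)) = ε * y.1 ^ 4 + y.2 ^ 3 := by
    have hl : Filter.Tendsto (fun y => A (ψ y)) (nhds 0) (nhds 0) := by
      have := (A.continuous.continuousAt.comp hψ.continuousAt).tendsto
      simpa [hψ0, Function.comp_def] using this
    filter_upwards [hφψ, hl.eventually hgφ] with y h1 h2
    rw [h2, h1]
  obtain ⟨_, _, _, _, _, _, _, _, _, c, H, K, R, hH, hK, hR, hexp⟩ := exists_contDiff_expansion hF
  obtain ⟨hexp, hH0⟩ := three_jet_of_comp_eq (F := fun p => g (A p)) hψ0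
    (hψ' ▸ (hψ.differentiableAt one_ne_zero).hasFDerivAt) hFψ hH.continuous hK.continuous
    hR.continuous hexp
  have hR0 : R (0, 0) = ε :=
    four_jet_of_comp_eq (F := fun p => g (A p)) hψ0 hψ hψ' hFψ hH hK hR hexp
  obtain ⟨a, H', K', R', hH', hK', hR', hH0', hR0', hshear⟩ :=
    exists_contDiff_shear hH hK hR (hR0 ▸ hε) c
  obtain ⟨b₃, b₁, b₀, w, hb₃, hb₁, hb₀, hw, hb₃0, hb₀0, hmain⟩ :=
    exists_contDiff_cubic_add_affine hH' hK' hR' (by rw [hH0', hH0]; exact one_ne_zero)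
  let S : (ℝ × ℝ) →ₗ[ℝ] ℝ × ℝ :=
    (LinearMap.fst ℝ ℝ ℝ - a • LinearMap.snd ℝ ℝ ℝ).prod (LinearMap.snd ℝ ℝ ℝ)
  have hS : ∀ x, S x = (x.1 - a * x.2, x.2) := fun x => rfl
  have hSbij : Function.Bijective S :=
    Function.bijective_iff_has_inverse.2 ⟨fun x => (x.1 + a * x.2, x.2),
      fun x => by simp [hS], fun x => by simp [hS]⟩
  have hAS : Filter.Tendsto (fun x => A (S x)) (nhds 0) (nhds 0) := by
    have hSc : Continuous S := S.continuous_of_finiteDimensional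
    have := (A.continuous.comp hSc).tendsto 0
    simpa [Function.comp_def] using this
  have hev : ∀ᶠ x in nhds (0 : ℝ × ℝ), φ (A (S x)) =
      b₃ x * (x.2 - x.1 ^ 2 * w x.1) ^ 3 + x.2 * x.1 ^ 4 * b₁ x.1 + x.1 ^ 4 * b₀ x.1 := by
    filter_upwards [hAS.eventually hgφ, (continuous_fst.tendsto (0 : ℝ × ℝ)).eventually hmain]
      with x h1 h2
    rw [← h2, ← hshear, ← h1, hS, hexp]
  obtain ⟨δ, hδ, hball⟩ := Metric.eventually_nhds_iff_ball.1 hev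
  exact ⟨(A : (ℝ × ℝ) →ₗ[ℝ] ℝ × ℝ) ∘ₗ S, A.bijective.comp hSbij, 2, le_rfl, b₃, b₁, b₀, w, δ, hδ,
    hb₃.contDiffOn, hb₁.contDiffOn, hb₀.contDiffOn, hw.contDiffOn,
    by rw [hb₃0, hH0', hH0]; exact one_ne_zero, by rwa [hb₀0, hR0', hR0], hball⟩
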